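/- Let n ≥ 1, B > -(n-2)²/4, 0 ≤ A < n−1+2ρ where ρ = ((2-n)+√((n-2)²+4B))/2, and set α = (n+A−1+2ρ)/2, γ = n−1+2ρ. For β ∈ ℝ, λ ≥ 0 and (t,r) with 0 < r < t+λ, define Ψ_β(t,r;λ) = r^ρ (t+r+λ)^{−β} F(α,β,γ; 2r/(t+r+λ)), where F is the hypergeometric function given by the Euler integral representation. Then for every fixed r and λ with 0 < r < t + λ, the partial derivative in t satisfies ∂_t Ψ_β(t,r;λ) = −β Ψ_{β+1}(t,r;λ). -/

import Mathlib

open MeasureTheory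

/-- The hypergeometric function via the Euler integral representation,
`F(α,β,γ;z) = (Γ(γ)/(Γ(α)Γ(γ−α))) ∫₀¹ s^(α−1) (1−s)^(γ−α−1) (1−zs)^(−β) ds`,
valid for `γ > α > 0` and `z < 1`. -/
noncomputable def hyperF (α β γ z : ℝ) : ℝ :=
  (Real.Gamma γ / (Real.Gamma α * Real.Gamma (γ - α))) *
    ∫ s in (0 : ℝ)..1, s ^ (α - 1) * (1 - s) ^ (γ - α - 1) * (1 - z * s) ^ (-β)

/-- The radial test function `Ψ_β(t,r;λ) = r^ρ (t+r+λ)^(−β) F(α,β,γ; 2r/(t+r+λ))`. -/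
noncomputable def PsiR (α γ ρ β lam t r : ℝ) : ℝ :=
  r ^ ρ * (t + r + lam) ^ (-β) * hyperF α β γ (2 * r / (t + r + lam))

open Filter Topology

/-- The Beta weight `s^(p-1) (1-s)^(q-1)` is integrable on `[0, 1]` for `p, q > 0`. -/
theorem intervalIntegrable_rpow_mul_one_sub_rpow {p q : ℝ} (hp : 0 < p) (hq : 0 < q) :
    IntervalIntegrable (fun s : ℝ => s ^ (p - 1) * (1 - s) ^ (q - 1)) volume 0 1 := by
  have h := (Complex.betaIntegral_convergent (u := p) (v := q) (by simpa) (by simpa)).norm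
  refine h.congr ?_
  intro s hs
  rw [Set.uIoc_of_le zero_le_one] at hs
  have h1 : (0 : ℝ) ≤ 1 - s := by linarith [hs.2]
  have e1 : (s : ℂ) ^ ((p : ℂ) - 1) = ((s ^ (p - 1) : ℝ) : ℂ) := by
    rw [Complex.ofReal_cpow hs.1.le]; push_cast; rfl
  have e2 : (1 - (s : ℂ)) ^ ((q : ℂ) - 1) = (((1 - s) ^ (q - 1) : ℝ) : ℂ) := by
    rw [Complex.ofReal_cpow h1]; push_cast; rfl
  simp only [e1, e2, ← Complex.ofReal_mul, Complex.norm_real, Real.norm_eq_abs]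
  exact abs_of_nonneg (mul_nonneg (Real.rpow_nonneg hs.1.le _) (Real.rpow_nonneg h1 _))

theorem continuousOn_sub_mul_rpow {c x : ℝ} (hc : 0 ≤ c) (hx : c < x) (p : ℝ) :
    ContinuousOn (fun s : ℝ => (x - c * s) ^ p) (Set.uIcc 0 1) := by
  refine ContinuousOn.rpow_const (by fun_prop) fun s hs => Or.inl ?_
  rw [Set.uIcc_of_le zero_le_one] at hs
  nlinarith [hs.1, hs.2]

/-- Differentiation under the integral sign for `x ↦ ∫₀¹ w(s) (x - c s)^p ds`. -/
theorem hasDerivAt_integral_mul_sub_mul_rpow {w : ℝ → ℝ}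
    (hw : IntervalIntegrable w volume 0 1) {c x : ℝ} (hc : 0 ≤ c) (hx : c < x) (p : ℝ) :
    HasDerivAt (fun y => ∫ s in (0 : ℝ)..1, w s * (y - c * s) ^ p)
      (p * ∫ s in (0 : ℝ)..1, w s * (x - c * s) ^ (p - 1)) x := by
  obtain ⟨a, hca, hax⟩ := exists_between hx
  have hint : ∀ (q y : ℝ), c < y →
      IntervalIntegrable (fun s => w s * (y - c * s) ^ q) volume 0 1 := fun q y hy =>
    hw.mul_continuousOn (continuousOn_sub_mul_rpow hc hy q)
  have hpos : ∀ s ∈ Set.uIoc (0 : ℝ) 1, ∀ y, a < y → a - c ≤ y - c * s ∧ y - c * s ≤ y := by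
    intro s hs y hy
    rw [Set.uIoc_of_le zero_le_one] at hs
    constructor <;> nlinarith [hs.1, hs.2]
  obtain ⟨K, hK⟩ := (isCompact_Icc (a := a - c) (b := x + 1)).exists_bound_of_continuousOn
    (f := fun y : ℝ => y ^ (p - 1)) (ContinuousOn.rpow_const continuousOn_id
      fun y hy => Or.inl (ne_of_gt (lt_of_lt_of_le (sub_pos.2 hca) hy.1)))
  have hd := intervalIntegral.hasDerivAt_integral_of_dominated_loc_of_deriv_le
    (μ := volume) (a := 0) (b := 1) (s := Set.Ioo a (x + 1))
    (F := fun y s => w s * (y - c * s) ^ p)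
    (F' := fun y s => p * (w s * (y - c * s) ^ (p - 1)))
    (bound := fun s => |p| * (‖w s‖ * K))
    (Ioo_mem_nhds hax (by linarith))
    ((eventually_gt_nhds hx).mono fun y hy => (intervalIntegrable_iff.1 (hint p y hy)).aestronglyMeasurable)
    (hint p x hx)
    (intervalIntegrable_iff.1 ((hint (p - 1) x hx).const_mul p)).aestronglyMeasurable
    (ae_of_all _ fun s hs y hy => ?_)
    ((hw.norm.mul_const K).const_mul _)
    (ae_of_all _ fun s hs y hy => ?_)
  · simpa only [intervalIntegral.integral_const_mul] using hd.2
  · have hb := hpos s hs y hy.1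
    rw [norm_mul, norm_mul, Real.norm_eq_abs p]
    gcongr
    exact hK _ ⟨hb.1, hb.2.trans hy.2.le⟩
  · have hb := hpos s hs y hy.1
    have h := (((hasDerivAt_id y).sub_const (c * s)).rpow_const (p := p)
      (Or.inl (ne_of_gt (lt_of_lt_of_le (sub_pos.2 hca) hb.1)))).const_mul (w s)
    refine h.congr_deriv ?_
    rw [id_eq]
    ring

theorem PsiR_eq_integral (α γ ρ β lam : ℝ) {t r : ℝ} (hr : 0 < r) (htr : r < t + lam) :
    PsiR α γ ρ β lam t r =
      r ^ ρ * (Real.Gamma γ / (Real.Gamma α * Real.Gamma (γ - α))) *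
        ∫ s in (0 : ℝ)..1,
          s ^ (α - 1) * (1 - s) ^ (γ - α - 1) * (t + r + lam - 2 * r * s) ^ (-β) := by
  have hu : 0 < t + r + lam := by linarith
  have key : (t + r + lam) ^ (-β) * (∫ s in (0 : ℝ)..1,
        s ^ (α - 1) * (1 - s) ^ (γ - α - 1) * (1 - 2 * r / (t + r + lam) * s) ^ (-β)) =
      ∫ s in (0 : ℝ)..1,
        s ^ (α - 1) * (1 - s) ^ (γ - α - 1) * (t + r + lam - 2 * r * s) ^ (-β) := by
    rw [← intervalIntegral.integral_const_mul]
    refine intervalIntegral.integral_congr fun s hs => ?_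
    rw [Set.uIcc_of_le zero_le_one] at hs
    have e : t + r + lam - 2 * r * s = (t + r + lam) * (1 - 2 * r / (t + r + lam) * s) := by
      field_simp
    have h1 : 0 ≤ 1 - 2 * r / (t + r + lam) * s := by
      refine nonneg_of_mul_nonneg_right ?_ hu
      rw [← e]
      nlinarith [hs.1, hs.2]
    simp only [e]
    rw [Real.mul_rpow hu.le h1]
    ring
  rw [PsiR, hyperF, ← key]
  ring

/-- with `ρ = ((2-n)+√((n-2)²+4B))/2`, `α = (n+A−1+2ρ)/2`,
`γ = n−1+2ρ`, `B > -(n-2)²/4` and `0 ≤ A < n−1+2ρ`, for every `β ∈ ℝ`,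
`λ ≥ 0` and `0 < r < t + λ` one has `∂_t Ψ_β(t,r;λ) = −β Ψ_(β+1)(t,r;λ)`. -/
theorem stmt5 (n : ℕ) (hn : 1 ≤ n) (A B : ℝ)
    (hB : -((n : ℝ) - 2) ^ 2 / 4 < B)
    (ρ : ℝ) (hρ : ρ = ((2 - (n : ℝ)) + Real.sqrt (((n : ℝ) - 2) ^ 2 + 4 * B)) / 2)
    (hA0 : 0 ≤ A) (hA1 : A < (n : ℝ) - 1 + 2 * ρ)
    (α γ : ℝ) (hα : α = ((n : ℝ) + A - 1 + 2 * ρ) / 2) (hγ : γ = (n : ℝ) - 1 + 2 * ρ)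
    (β lam t r : ℝ) (hlam : 0 ≤ lam) (hr : 0 < r) (htr : r < t + lam) :
    deriv (fun t' => PsiR α γ ρ β lam t' r) t = -β * PsiR α γ ρ (β + 1) lam t r := by
  have hw := intervalIntegrable_rpow_mul_one_sub_rpow (p := α) (q := γ - α)
    (by linarith) (by linarith)
  have hd := ((hasDerivAt_integral_mul_sub_mul_rpow hw (c := 2 * r) (x := t + r + lam)
    (by linarith) (by linarith) (-β)).comp t
      (((hasDerivAt_id t).add_const r).add_const lam)).const_mul
        (r ^ ρ * (Real.Gamma γ / (Real.Gamma α * Real.Gamma (γ - α))))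
  have hev : (fun t' => PsiR α γ ρ β lam t' r) =ᶠ[𝓝 t] _ :=
    (eventually_gt_nhds (show r - lam < t by linarith)).mono fun t' ht' =>
      PsiR_eq_integral α γ ρ β lam hr (show r < t' + lam by linarith)
  refine (hd.congr_of_eventuallyEq hev).deriv.trans ?_
  rw [PsiR_eq_integral α γ ρ (β + 1) lam hr htr, neg_add']
  ring
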